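/- Let G_1, G_2 : [0,1] → ℝ be two independent standard Brownian bridges, and let a, b, h ∈ ℝ. Then P( max_{w∈[0,1]} max{ G_1(w)+G_2(w)+a(1−w)+bw , −G_1(w)+G_2(w)−a(1−w)+bw } < h ) = (1 − e^{−(h−a)(h−b)}) · (1 − e^{−(h+a)(h−b)}) when h > |a| and h > b, and the probability is 0 otherwise. -/

import Mathlib

open MeasureTheory ProbabilityTheory Set

namespace BrownianBridgeMax

/-- Covariance of the standard Brownian bridge on `[0, 1]`: `min s t * (1 − max s t)`. -/
noncomputable def bridgeCov (s t : ℝ) : ℝ := min s t * (1 - max s t)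

open scoped NNReal ENNReal

section GaussPart

lemma bridge_quad_nonneg {s t : ℝ} (hs : s ∈ Icc (0 : ℝ) 1) (ht : t ∈ Icc (0 : ℝ) 1) (x y : ℝ) :
    0 ≤ x * x * bridgeCov s s + x * y * bridgeCov s t + y * x * bridgeCov t s
      + y * y * bridgeCov t t := by
  wlog hst : s ≤ t generalizing s t x y
  · have := this ht hs y x (le_of_not_ge hst)
    linarith
  simp only [bridgeCov, min_self, max_self, min_eq_left hst, max_eq_right hst, min_eq_right hst,
    max_eq_left hst]
  have h1 : 0 ≤ s * (1 - t) * (x + y) ^ 2 :=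
    mul_nonneg (mul_nonneg hs.1 (by linarith [ht.2])) (sq_nonneg _)
  have h2 : 0 ≤ s * (t - s) * x ^ 2 :=
    mul_nonneg (mul_nonneg hs.1 (by linarith)) (sq_nonneg _)
  have h3 : 0 ≤ (t - s) * (1 - t) * y ^ 2 :=
    mul_nonneg (mul_nonneg (by linarith) (by linarith [ht.2])) (sq_nonneg _)
  nlinarith

variable {Ω : Type*} [MeasurableSpace Ω] {μ : Measure Ω}
    {G₁ G₂ : ℝ → Ω → ℝ}

lemma pair_law
    (hGauss : ∀ (n : ℕ) (ts : Fin n → ℝ) (c d : Fin n → ℝ),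
      (∀ i, ts i ∈ Icc (0 : ℝ) 1) →
      Measure.map (fun ω => ∑ i, (c i * G₁ (ts i) ω + d i * G₂ (ts i) ω)) μ =
        gaussianReal 0 (Real.toNNReal (∑ i, ∑ j,
          (c i * c j + d i * d j) * bridgeCov (ts i) (ts j))))
    {s t : ℝ} (hs : s ∈ Icc (0 : ℝ) 1) (ht : t ∈ Icc (0 : ℝ) 1) (α β γ δ : ℝ) :
    HasLaw (fun ω => (α * G₁ s ω + β * G₂ s ω) + (γ * G₁ t ω + δ * G₂ t ω))
      (gaussianReal 0 (Real.toNNReal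
        ((α * α + β * β) * bridgeCov s s + (α * γ + β * δ) * bridgeCov s t
        + (γ * α + δ * β) * bridgeCov t s + (γ * γ + δ * δ) * bridgeCov t t))) μ := by
  have := hGauss 2 ![s, t] ![α, γ] ![β, δ] (by intro i; fin_cases i <;> simpa)
  simp only [Fin.sum_univ_two, Matrix.cons_val_zero, Matrix.cons_val_one] at this
  refine ⟨?_, ?_⟩
  · exact aemeasurable_of_map_neZero (by rw [this]; infer_instance)
  · rw [this]
    congr 2
    ring

lemma single_law
    (hGauss : ∀ (n : ℕ) (ts : Fin n → ℝ) (c d : Fin n → ℝ),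
      (∀ i, ts i ∈ Icc (0 : ℝ) 1) →
      Measure.map (fun ω => ∑ i, (c i * G₁ (ts i) ω + d i * G₂ (ts i) ω)) μ =
        gaussianReal 0 (Real.toNNReal (∑ i, ∑ j,
          (c i * c j + d i * d j) * bridgeCov (ts i) (ts j))))
    {s : ℝ} (hs : s ∈ Icc (0 : ℝ) 1) (α β : ℝ) :
    HasLaw (fun ω => α * G₁ s ω + β * G₂ s ω)
      (gaussianReal 0 (Real.toNNReal ((α * α + β * β) * bridgeCov s s))) μ := by
  have := pair_law hGauss hs hs α β 0 0
  simpa using this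

lemma bridge_cov [IsProbabilityMeasure μ]
    (hGauss : ∀ (n : ℕ) (ts : Fin n → ℝ) (c d : Fin n → ℝ),
      (∀ i, ts i ∈ Icc (0 : ℝ) 1) →
      Measure.map (fun ω => ∑ i, (c i * G₁ (ts i) ω + d i * G₂ (ts i) ω)) μ =
        gaussianReal 0 (Real.toNNReal (∑ i, ∑ j,
          (c i * c j + d i * d j) * bridgeCov (ts i) (ts j))))
    {s t : ℝ} (hs : s ∈ Icc (0 : ℝ) 1) (ht : t ∈ Icc (0 : ℝ) 1) (α β γ δ : ℝ) :
    cov[fun ω => α * G₁ s ω + β * G₂ s ω, fun ω => γ * G₁ t ω + δ * G₂ t ω; μ] =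
      (α * γ + β * δ) * bridgeCov s t := by
  have h1 := single_law hGauss hs α β
  have h2 := single_law hGauss ht γ δ
  have h3 := pair_law hGauss hs ht α β γ δ
  have h4 := variance_fun_add h1.hasGaussianLaw.memLp_two h2.hasGaussianLaw.memLp_two
  have hc : bridgeCov t s = bridgeCov s t := by simp [bridgeCov, min_comm, max_comm]
  have q1 := bridge_quad_nonneg hs ht α γ
  have q2 := bridge_quad_nonneg hs ht β δ
  have q3 := bridge_quad_nonneg hs hs α 0
  have q4 := bridge_quad_nonneg hs hs β 0
  have q5 := bridge_quad_nonneg ht ht γ 0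
  have q6 := bridge_quad_nonneg ht ht δ 0
  rw [h1.variance_eq, h2.variance_eq, h3.variance_eq] at h4
  simp only [variance_id_gaussianReal] at h4
  rw [Real.coe_toNNReal _ (by linarith), Real.coe_toNNReal _ (by linarith),
    Real.coe_toNNReal _ (by linarith), hc] at h4
  linarith

lemma bridge_gaussianProcess [IsProbabilityMeasure μ]
    (hmeas₁ : ∀ w : ℝ, Measurable (G₁ w)) (hmeas₂ : ∀ w : ℝ, Measurable (G₂ w))
    (hGauss : ∀ (n : ℕ) (ts : Fin n → ℝ) (c d : Fin n → ℝ),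
      (∀ i, ts i ∈ Icc (0 : ℝ) 1) →
      Measure.map (fun ω => ∑ i, (c i * G₁ (ts i) ω + d i * G₂ (ts i) ω)) μ =
        gaussianReal 0 (Real.toNNReal (∑ i, ∑ j,
          (c i * c j + d i * d j) * bridgeCov (ts i) (ts j))))
    {T : Type*} (α β w : T → ℝ) (hw : ∀ t, w t ∈ Icc (0 : ℝ) 1) :
    IsGaussianProcess (fun t ω => α t * G₁ (w t) ω + β t * G₂ (w t) ω) μ := by
  classical
  refine ⟨fun I => ⟨isGaussian_of_map_eq_gaussianReal fun L => ⟨0, ?_⟩⟩⟩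
  have hm : Measurable (fun ω => I.restrict (fun t => α t * G₁ (w t) ω + β t * G₂ (w t) ω)) := by
    refine measurable_pi_lambda _ fun t => ?_
    simp only [Finset.restrict]
    exact ((hmeas₁ _).const_mul _).add ((hmeas₂ _).const_mul _)
  rw [Measure.map_map (by fun_prop) hm]
  let e := I.equivFin
  refine ⟨_, Eq.trans ?_ (hGauss I.card (fun i => w (e.symm i))
    (fun i => L (Pi.single (e.symm i) 1) * α (e.symm i))
    (fun i => L (Pi.single (e.symm i) 1) * β (e.symm i)) (fun i => hw _))⟩
  congr 1
  ext ω
  simp only [Function.comp]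
  rw [e.symm.sum_comp (fun j : I => L (Pi.single j 1) * α j * G₁ (w j) ω +
      L (Pi.single j 1) * β j * G₂ (w j) ω)]
  conv_lhs => rw [← Finset.univ_sum_single
    (I.restrict (fun t => α t * G₁ (w t) ω + β t * G₂ (w t) ω)), map_sum]
  refine Finset.sum_congr rfl fun j _ => ?_
  have : (Pi.single j (I.restrict (fun t => α t * G₁ (w t) ω + β t * G₂ (w t) ω) j) : I → ℝ) =
      (α j * G₁ (w j) ω + β j * G₂ (w j) ω) • (Pi.single j (1 : ℝ) : I → ℝ) := by
    rw [← Pi.single_smul]; simp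
  rw [this, map_smul, smul_eq_mul]
  ring

/-- The Brownian motion built from a rotated pair of bridges. -/
noncomputable def bm (G₁ G₂ : ℝ → Ω → ℝ) (σ : ℝ) (t : ℝ≥0) (ω : Ω) : ℝ :=
  ((1 + t) * σ / √2) * G₁ (t / (1 + t)) ω + ((1 + t) / √2) * G₂ (t / (1 + t)) ω

lemma w_mem (t : ℝ≥0) : (t : ℝ) / (1 + t) ∈ Icc (0 : ℝ) 1 := by
  have : (0 : ℝ) ≤ t := t.2
  refine ⟨by positivity, ?_⟩
  rw [div_le_one (by positivity)]
  linarith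

lemma bridgeCov_w {s t : ℝ≥0} (hst : s ≤ t) :
    bridgeCov ((s : ℝ) / (1 + s)) ((t : ℝ) / (1 + t)) = s / ((1 + s) * (1 + t)) := by
  have h1 : (0 : ℝ) ≤ s := s.2
  have h2 : (0 : ℝ) ≤ t := t.2
  have h3 : (s : ℝ) ≤ t := hst
  have : (s : ℝ) / (1 + s) ≤ (t : ℝ) / (1 + t) := by
    rw [div_le_div_iff₀ (by positivity) (by positivity)]
    nlinarith
  rw [bridgeCov, min_eq_left this, max_eq_right this]
  field_simp
  ring

lemma bm_preBrownian [IsProbabilityMeasure μ]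
    (hmeas₁ : ∀ w : ℝ, Measurable (G₁ w)) (hmeas₂ : ∀ w : ℝ, Measurable (G₂ w))
    (hGauss : ∀ (n : ℕ) (ts : Fin n → ℝ) (c d : Fin n → ℝ),
      (∀ i, ts i ∈ Icc (0 : ℝ) 1) →
      Measure.map (fun ω => ∑ i, (c i * G₁ (ts i) ω + d i * G₂ (ts i) ω)) μ =
        gaussianReal 0 (Real.toNNReal (∑ i, ∑ j,
          (c i * c j + d i * d j) * bridgeCov (ts i) (ts j))))
    {σ : ℝ} (hσ : σ ^ 2 = 1) : IsPreBrownianReal (bm G₁ G₂ σ) μ := by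
  refine IsGaussianProcess.isPreBrownianReal_of_covariance ?_ (fun t => ?_) (fun s t hst => ?_)
  · exact bridge_gaussianProcess hmeas₁ hmeas₂ hGauss _ _ _ w_mem
  · have := (single_law hGauss (w_mem t) ((1 + t) * σ / √2) ((1 + t) / √2)).integral_eq
    rw [integral_id_gaussianReal] at this
    exact this
  · unfold bm
    rw [bridge_cov hGauss (w_mem s) (w_mem t), bridgeCov_w hst]
    have h1 : (0 : ℝ) ≤ s := s.2
    have h2 : (0 : ℝ) ≤ t := t.2
    have h3 : √(2:ℝ) ^ 2 = 2 := by norm_num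
    field_simp
    rw [hσ, h3]; norm_num

lemma bm_indep [IsProbabilityMeasure μ]
    (hmeas₁ : ∀ w : ℝ, Measurable (G₁ w)) (hmeas₂ : ∀ w : ℝ, Measurable (G₂ w))
    (hGauss : ∀ (n : ℕ) (ts : Fin n → ℝ) (c d : Fin n → ℝ),
      (∀ i, ts i ∈ Icc (0 : ℝ) 1) →
      Measure.map (fun ω => ∑ i, (c i * G₁ (ts i) ω + d i * G₂ (ts i) ω)) μ =
        gaussianReal 0 (Real.toNNReal (∑ i, ∑ j,
          (c i * c j + d i * d j) * bridgeCov (ts i) (ts j)))) :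
    IndepFun (fun ω t => bm G₁ G₂ 1 t ω) (fun ω t => bm G₁ G₂ (-1) t ω) μ := by
  have hm : ∀ σ t, Measurable (bm G₁ G₂ σ t) := fun σ t =>
    ((hmeas₁ _).const_mul _).add ((hmeas₂ _).const_mul _)
  apply IsGaussianProcess.indepFun_of_covariance_eq_zero
  · have := bridge_gaussianProcess hmeas₁ hmeas₂ hGauss (T := ℝ≥0 ⊕ ℝ≥0)
      (Sum.elim (fun t => (1 + t) * 1 / √2) (fun t => (1 + t) * (-1) / √2))
      (Sum.elim (fun t => (1 + t) / √2) (fun t => (1 + t) / √2))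
      (Sum.elim (fun t => (t : ℝ) / (1 + t)) (fun t => (t : ℝ) / (1 + t)))
      (by rintro (t | t) <;> exact w_mem t)
    convert this using 1
    ext (t | t) ω <;> rfl
  · exact fun t => (hm _ _).aemeasurable
  · exact fun t => (hm _ _).aemeasurable
  · intro s t
    unfold bm
    rw [bridge_cov hGauss (w_mem s) (w_mem t)]
    ring

end GaussPart

section MartPart

set_option linter.unusedSectionVars false

open Filter Topology

variable {Ω : Type*} [MeasurableSpace Ω] {μ : Measure Ω}

lemma gauss_exp {ξ : Ω → ℝ} {v : ℝ≥0} (h : HasLaw ξ (gaussianReal 0 v) μ) (a : ℝ) :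
    Integrable (fun ω => Real.exp (a * ξ ω)) μ ∧
      ∫ ω, Real.exp (a * ξ ω) ∂μ = Real.exp (v * a ^ 2 / 2) := by
  constructor
  · have := integrable_exp_mul_gaussianReal (μ := 0) (v := v) a
    rw [← h.map_eq] at this
    exact this.comp_aemeasurable h.aemeasurable
  · have := mgf_gaussianReal h.map_eq a
    simpa [mgf] using this

/-- The exponential martingale. -/
noncomputable def mart (B : ℝ≥0 → Ω → ℝ) (d : ℝ) (t : ℝ≥0) (ω : Ω) : ℝ :=
  Real.exp (2 * d * B t ω - 2 * d ^ 2 * t)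

/-- No crossing of the line `c + d t` at times `0, δ, …, k δ`. -/
def noHit (B : ℝ≥0 → Ω → ℝ) (c d : ℝ) (δ : ℝ≥0) (k : ℕ) : Set Ω :=
  {ω | ∀ j : ℕ, j ≤ k → B (j * δ) ω < c + d * (j * δ)}

variable {B : ℝ≥0 → Ω → ℝ} {c d : ℝ} {δ : ℝ≥0}

lemma mart_pos (t : ℝ≥0) (ω : Ω) : 0 < mart B d t ω := Real.exp_pos _

lemma noHit_succ_subset (k : ℕ) : noHit B c d δ (k + 1) ⊆ noHit B c d δ k :=
  fun _ h j hj => h j (by omega)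

lemma mart_lt (hd : 0 < d) {ω : Ω} {j : ℕ} :
    B (j * δ) ω < c + d * (j * δ) ↔ mart B d (j * δ) ω < Real.exp (2 * d * c) := by
  unfold mart
  rw [Real.exp_lt_exp]
  push_cast
  constructor <;> intro h
  · nlinarith
  · by_contra! h'
    nlinarith

lemma measurable_mart (hm : ∀ t, Measurable (B t)) (t : ℝ≥0) : Measurable (mart B d t) := by
  have := hm t
  unfold mart
  fun_prop

lemma measurableSet_noHit (hm : ∀ t, Measurable (B t)) (k : ℕ) :
    MeasurableSet (noHit B c d δ k) := by
  have : noHit B c d δ k = ⋂ j : ℕ, ⋂ (_ : j ≤ k), {ω | B (j * δ) ω < c + d * (j * δ)} := by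
    ext; simp [noHit]
  rw [this]
  exact .iInter fun j => .iInter fun _ => measurableSet_lt (hm _) measurable_const

lemma integrable_mart (hB : IsPreBrownianReal B μ) (t : ℝ≥0) : Integrable (mart B d t) μ := by
  have := (gauss_exp (hB.hasLaw_eval t) (2 * d)).1
  unfold mart
  simp_rw [sub_eq_add_neg, Real.exp_add]
  exact this.mul_const _

/-- one-step ratio -/
noncomputable def ratio (B : ℝ≥0 → Ω → ℝ) (d : ℝ) (s δ : ℝ≥0) (ω : Ω) : ℝ :=
  Real.exp (2 * d * (B (s + δ) ω - B s ω) - 2 * d ^ 2 * δ)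

lemma ratio_pow (hB : IsPreBrownianReal B μ) (s : ℝ≥0) (p : ℕ) :
    Integrable (fun ω => ratio B d s δ ω ^ p) μ ∧
      ∫ ω, ratio B d s δ ω ^ p ∂μ = Real.exp (2 * d ^ 2 * δ * (p * (p - 1))) := by
  have h1 : HasLaw (fun ω => B (s + δ) ω - B s ω) (gaussianReal 0 δ) μ := by
    have := hB.hasLaw_sub (s + δ) s
    have e : nndist ((s + δ : ℝ≥0) : ℝ) (s : ℝ) = δ := by
      apply NNReal.coe_injective
      rw [coe_nndist, Real.dist_eq]
      simp
    change HasLaw _ (gaussianReal 0 (nndist ((s + δ : ℝ≥0) : ℝ) (s : ℝ))) μ at this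
    rw [e] at this
    exact this
  have h2 := gauss_exp h1 (p * (2 * d))
  have h3 : ∀ ω, ratio B d s δ ω ^ p =
      Real.exp (p * (2 * d) * (B (s + δ) ω - B s ω)) * Real.exp (- (p * (2 * d ^ 2 * δ))) := by
    intro ω
    rw [ratio, ← Real.exp_nat_mul, ← Real.exp_add]
    congr 1; ring
  simp_rw [h3]
  refine ⟨h2.1.mul_const _, ?_⟩
  rw [integral_mul_const, h2.2, ← Real.exp_add]
  congr 1; ring

lemma mart_step (s : ℝ≥0) (ω : Ω) : mart B d (s + δ) ω = ratio B d s δ ω * mart B d s ω := by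
  rw [mart, mart, ratio, ← Real.exp_add]
  congr 1; push_cast; ring

lemma setIntegral_mart_succ (hB : IsPreBrownianReal B μ) (hm : ∀ t, Measurable (B t)) (k : ℕ) :
    ∫ ω in noHit B c d δ k, mart B d ((k + 1 : ℕ) * δ) ω ∂μ =
      ∫ ω in noHit B c d δ k, mart B d (k * δ) ω ∂μ := by
  have hk : (((k + 1 : ℕ) : ℝ≥0) * δ) = k * δ + δ := by push_cast; ring
  rw [hk, ← integral_indicator (measurableSet_noHit hm k),
    ← integral_indicator (measurableSet_noHit hm k)]
  have hind := hB.indepFun_shift (k * δ)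
  let φ : (ℝ≥0 → ℝ) → ℝ := fun f => Real.exp (2 * d * f δ - 2 * d ^ 2 * δ)
  have hle : ∀ j : ℕ, j ≤ k → (j : ℝ≥0) * δ ≤ k * δ := fun j hj => by gcongr
  let S : Set (Iic ((k : ℝ≥0) * δ) → ℝ) :=
    ⋂ j : ℕ, ⋂ (hj : j ≤ k), {g | g ⟨j * δ, hle j hj⟩ < c + d * (j * δ)}
  have hS : MeasurableSet S :=
    .iInter fun j => .iInter fun _ => measurableSet_lt (measurable_pi_apply _) measurable_const
  let ψ : (Iic ((k : ℝ≥0) * δ) → ℝ) → ℝ :=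
    S.indicator fun g => Real.exp (2 * d * g ⟨k * δ, hle k le_rfl⟩ - 2 * d ^ 2 * (k * δ))
  have hφ : Measurable φ := by fun_prop
  have hψ : Measurable ψ := by
    refine Measurable.indicator ?_ hS
    fun_prop
  have hi := hind.comp hφ hψ
  have e1 : φ ∘ (fun ω t => B (k * δ + t) ω - B (k * δ) ω) = ratio B d (k * δ) δ := rfl
  have e2 : ψ ∘ (fun ω (t : Iic ((k : ℝ≥0) * δ)) => B t ω) =
      (noHit B c d δ k).indicator (mart B d (k * δ)) := by
    ext ω
    simp only [ψ, Function.comp, indicator, S, noHit, mem_iInter, mem_ofPred_eq, mart]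
    push_cast
    rfl
  rw [e1, e2] at hi
  have e3 : (noHit B c d δ k).indicator (mart B d (k * δ + δ)) =
      ratio B d (k * δ) δ * (noHit B c d δ k).indicator (mart B d (k * δ)) := by
    ext ω
    by_cases h : ω ∈ noHit B c d δ k
    · simp [h, mart_step]
    · simp [h]
  have hr := ratio_pow (d := d) (δ := δ) hB (k * δ) 1
  simp only [pow_one] at hr
  rw [e3, hi.integral_mul_eq_mul_integral hr.1.aestronglyMeasurable
    ((measurable_mart hm _).indicator (measurableSet_noHit hm k)).aestronglyMeasurable, hr.2]
  simp

lemma jump_upper {ε : ℝ} (hε : 0 < ε) (hd : 0 < d) (p k : ℕ) {ω : Ω}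
    (h : ω ∈ noHit B c d δ k) :
    mart B d ((k + 1 : ℕ) * δ) ω ≤ (1 + ε) * Real.exp (2 * d * c) +
      Real.exp (2 * d * c) * ((1 + ε) ^ p)⁻¹ * ratio B d (k * δ) δ ω ^ (p + 1) := by
  have hk : (((k + 1 : ℕ) : ℝ≥0) * δ) = k * δ + δ := by push_cast; ring
  rw [hk, mart_step]
  have h1 : mart B d (k * δ) ω < Real.exp (2 * d * c) := (mart_lt hd).1 (h k le_rfl)
  have h2 : 0 < mart B d (k * δ) ω := mart_pos _ _
  set R := ratio B d (k * δ) δ ω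
  have hR : 0 < R := Real.exp_pos _
  have hK := Real.exp_pos (2 * d * c)
  set K := Real.exp (2 * d * c)
  have h3 : R * mart B d (k * δ) ω ≤ R * K := by gcongr
  refine h3.trans ?_
  by_cases hc : R ≤ 1 + ε
  · have : R * K ≤ (1 + ε) * K := by gcongr
    have : 0 ≤ K * ((1 + ε) ^ p)⁻¹ * R ^ (p + 1) := by positivity
    linarith
  · push Not at hc
    have : (1 + ε) ^ p ≤ R ^ p := by gcongr
    have h5 : 1 ≤ ((1 + ε) ^ p)⁻¹ * R ^ p := by
      rw [inv_mul_eq_div, le_div_iff₀ (by positivity)]; linarith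
    have : R * K * 1 ≤ R * K * (((1 + ε) ^ p)⁻¹ * R ^ p) := by gcongr
    have h6 : 0 ≤ (1 + ε) * K := by positivity
    calc R * K ≤ R * K * (((1 + ε) ^ p)⁻¹ * R ^ p) := by linarith
      _ = K * ((1 + ε) ^ p)⁻¹ * R ^ (p + 1) := by ring
      _ ≤ _ := by linarith

lemma main_ineq [IsProbabilityMeasure μ] (hB : IsPreBrownianReal B μ) (hm : ∀ t, Measurable (B t))
    (hB0 : ∀ ω, B 0 ω = 0) (hc : 0 < c) (hd : 0 < d) {ε : ℝ} (hε : 0 < ε) (p N : ℕ) :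
    Real.exp (2 * d * c) * (1 - μ.real (noHit B c d δ N)) ≤
      1 - ∫ ω in noHit B c d δ N, mart B d (N * δ) ω ∂μ ∧
    1 - ∫ ω in noHit B c d δ N, mart B d (N * δ) ω ∂μ ≤
      (1 + ε) * Real.exp (2 * d * c) * (1 - μ.real (noHit B c d δ N)) +
      N * (Real.exp (2 * d * c) * ((1 + ε) ^ p)⁻¹ *
        Real.exp (2 * d ^ 2 * δ * (p * (p + 1)))) := by
  induction N with
  | zero =>
    have h0 : noHit B c d δ 0 = univ := by
      ext ω; simp [noHit, hB0, hc]
    simp [h0, mart, hB0]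
  | succ k ih =>
    have hA := measurableSet_noHit (c := c) (d := d) (δ := δ) hm k
    have hA' := measurableSet_noHit (c := c) (d := d) (δ := δ) hm (k + 1)
    have hsub := noHit_succ_subset (B := B) (c := c) (d := d) (δ := δ) k
    have hint := integrable_mart (d := d) hB ((k + 1 : ℕ) * δ)
    set A := noHit B c d δ k with hAdef
    set A' := noHit B c d δ (k + 1) with hAdef'
    set K := Real.exp (2 * d * c) with hK
    have hKpos : 0 < K := Real.exp_pos _
    have hsplit : ∫ ω in A, mart B d ((k + 1 : ℕ) * δ) ω ∂μ =
        ∫ ω in A', mart B d ((k + 1 : ℕ) * δ) ω ∂μ +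
        ∫ ω in A \ A', mart B d ((k + 1 : ℕ) * δ) ω ∂μ := by
      rw [setIntegral_sdiff hA' hint.integrableOn hsub]; ring
    rw [setIntegral_mart_succ hB hm k] at hsplit
    have hmeas : μ.real (A \ A') = μ.real A - μ.real A' := measureReal_sdiff hsub hA'
    have hr := ratio_pow (d := d) (δ := δ) hB (k * δ) (p + 1)
    have hlow : K * μ.real (A \ A') ≤ ∫ ω in A \ A', mart B d ((k + 1 : ℕ) * δ) ω ∂μ := by
      have : ∫ ω in A \ A', K ∂μ ≤ ∫ ω in A \ A', mart B d ((k + 1 : ℕ) * δ) ω ∂μ := by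
        refine setIntegral_mono_on (by simp) hint.integrableOn (hA.diff hA') ?_
        rintro ω ⟨h1, h2⟩
        by_contra! h3
        apply h2
        intro j hj
        rcases Nat.lt_or_ge j (k + 1) with h4 | h4
        · exact h1 j (by omega)
        · obtain rfl : j = k + 1 := by omega
          exact (mart_lt hd).2 h3
      rw [setIntegral_const, smul_eq_mul] at this
      linarith
    have hup : ∫ ω in A \ A', mart B d ((k + 1 : ℕ) * δ) ω ∂μ ≤
        (1 + ε) * K * μ.real (A \ A') + K * ((1 + ε) ^ p)⁻¹ *
        Real.exp (2 * d ^ 2 * δ * (p * (p + 1))) := by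
      have i2 : Integrable (fun ω => K * ((1 + ε) ^ p)⁻¹ * ratio B d (k * δ) δ ω ^ (p + 1)) μ :=
        hr.1.const_mul _
      have h1 : ∫ ω in A \ A', mart B d ((k + 1 : ℕ) * δ) ω ∂μ ≤
          ∫ ω in A \ A', ((1 + ε) * K +
            K * ((1 + ε) ^ p)⁻¹ * ratio B d (k * δ) δ ω ^ (p + 1)) ∂μ := by
        refine setIntegral_mono_on hint.integrableOn
          ((integrable_const _).add i2).integrableOn (hA.diff hA') ?_
        rintro ω ⟨h1, h2⟩
        exact jump_upper hε hd p k h1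
      rw [integral_add (integrable_const _) i2.integrableOn, setIntegral_const, smul_eq_mul] at h1
      have h2 : ∫ ω in A \ A', K * ((1 + ε) ^ p)⁻¹ * ratio B d (k * δ) δ ω ^ (p + 1) ∂μ ≤
          ∫ ω, K * ((1 + ε) ^ p)⁻¹ * ratio B d (k * δ) δ ω ^ (p + 1) ∂μ := by
        refine setIntegral_le_integral i2 (ae_of_all _ fun ω => ?_)
        have : 0 < ratio B d (k * δ) δ ω := Real.exp_pos _
        simp only [Pi.zero_apply]
        positivity
      rw [integral_const_mul (K * ((1 + ε) ^ p)⁻¹) (fun ω => ratio B d (k * δ) δ ω ^ (p + 1))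
        (μ := μ), hr.2] at h2
      push_cast at h2
      rw [add_sub_cancel_right] at h2
      have h3 : ((p : ℝ) + 1) * p = p * (p + 1) := by ring
      rw [h3] at h2
      linarith
    rw [hmeas] at hlow hup
    obtain ⟨ih1, ih2⟩ := ih
    constructor
    · linarith
    · push_cast at *
      linarith

lemma tail_bound [IsProbabilityMeasure μ] (hB : IsPreBrownianReal B μ)
    (hm : ∀ t, Measurable (B t)) (hd : 0 < d) (N : ℕ) :
    0 ≤ ∫ ω in noHit B c d δ N, mart B d (N * δ) ω ∂μ ∧
    ∫ ω in noHit B c d δ N, mart B d (N * δ) ω ∂μ ≤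
      Real.exp (d * c) * Real.exp (- (d ^ 2 * (N * δ) / 2)) := by
  have hint := integrable_mart (d := d) hB (N * δ)
  have hg := gauss_exp (hB.hasLaw_eval (N * δ)) d
  refine ⟨integral_nonneg fun ω => (mart_pos _ _).le, ?_⟩
  have i2 : Integrable (fun ω => Real.exp (d * c) * Real.exp (- (d ^ 2 * (N * δ))) *
      Real.exp (d * B (N * δ) ω)) μ := hg.1.const_mul _
  have h1 : ∫ ω in noHit B c d δ N, mart B d (N * δ) ω ∂μ ≤
      ∫ ω in noHit B c d δ N, Real.exp (d * c) * Real.exp (- (d ^ 2 * (N * δ))) *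
      Real.exp (d * B (N * δ) ω) ∂μ := by
    refine setIntegral_mono_on hint.integrableOn i2.integrableOn (measurableSet_noHit hm N) ?_
    intro ω h
    have := h N le_rfl
    rw [mart, ← Real.exp_add, ← Real.exp_add, Real.exp_le_exp]
    push_cast
    nlinarith
  have h2 := setIntegral_le_integral (s := noHit B c d δ N) i2
    (ae_of_all _ fun ω => by simp only [Pi.zero_apply]; positivity)
  refine (h1.trans h2).trans (le_of_eq ?_)
  rw [integral_const_mul, hg.2, mul_assoc, ← Real.exp_add]
  congr 2
  push_cast
  ring

end MartPart

section LimitPart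

open Filter Topology

variable {Ω : Type*} [MeasurableSpace Ω] {μ : Measure Ω} {B : ℝ≥0 → Ω → ℝ} {c d : ℝ}

/-- No crossing of the line `c + d t` at dyadic times. -/
def noHitAll (B : ℝ≥0 → Ω → ℝ) (c d : ℝ) : Set Ω :=
  ⋂ n : ℕ, noHit B c d ((4 : ℝ≥0) ^ n)⁻¹ (8 ^ n)

set_option linter.unusedSectionVars false in
lemma noHit_antitone : Antitone fun n : ℕ => noHit B c d ((4 : ℝ≥0) ^ n)⁻¹ (8 ^ n) := by
  refine antitone_nat_of_succ_le fun n ω h j hj => ?_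
  have := h (4 * j) (by rw [pow_succ]; omega)
  have e : ((4 * j : ℕ) : ℝ≥0) * ((4 : ℝ≥0) ^ (n + 1))⁻¹ = j * ((4 : ℝ≥0) ^ n)⁻¹ := by
    push_cast
    rw [pow_succ]
    field_simp
  have e' := congrArg (NNReal.toReal) e
  push_cast at e' this ⊢
  push_cast at e
  rw [e, e'] at this
  exact this

lemma measurableSet_noHitAll (hm : ∀ t, Measurable (B t)) :
    MeasurableSet (noHitAll B c d) :=
  .iInter fun _ => measurableSet_noHit hm _

lemma err_tendsto (ε K : ℝ) (hε : 0 < ε) (hK : 0 < K) :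
    Tendsto (fun n : ℕ => ((8 ^ n : ℕ) : ℝ) * (K * ((1 + ε) ^ (2 ^ n : ℕ))⁻¹ *
        Real.exp (2 * d ^ 2 * (((4 : ℝ≥0) ^ n)⁻¹ : ℝ≥0) *
          (((2 ^ n : ℕ) : ℝ) * (((2 ^ n : ℕ) : ℝ) + 1))))) atTop (𝓝 0) := by
  have h1 := tendsto_pow_const_div_const_pow_of_one_lt 3 (r := 1 + ε) (by linarith)
  have h2 : Tendsto (fun n : ℕ => 2 ^ n) atTop atTop :=
    tendsto_pow_atTop_atTop_of_one_lt (by norm_num)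
  have h3 := (h1.comp h2).const_mul (K * Real.exp (4 * d ^ 2))
  rw [mul_zero] at h3
  refine squeeze_zero (fun n => by positivity) (fun n => ?_) h3
  simp only [Function.comp]
  have h4 : Real.exp (2 * d ^ 2 * (((4 : ℝ≥0) ^ n)⁻¹ : ℝ≥0) *
          (((2 ^ n : ℕ) : ℝ) * (((2 ^ n : ℕ) : ℝ) + 1))) ≤ Real.exp (4 * d ^ 2) := by
    rw [Real.exp_le_exp]
    push_cast
    have e : (4 : ℝ) ^ n = 2 ^ n * 2 ^ n := by rw [← mul_pow]; norm_num
    have h5 : (1 : ℝ) ≤ 2 ^ n := one_le_pow₀ (by norm_num)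
    have : ((4 : ℝ) ^ n)⁻¹ * (2 ^ n * (2 ^ n + 1)) ≤ 2 := by
      rw [e, inv_mul_eq_div, div_le_iff₀ (by positivity)]
      nlinarith
    calc 2 * d ^ 2 * ((4 : ℝ) ^ n)⁻¹ * (2 ^ n * (2 ^ n + 1))
        = 2 * d ^ 2 * (((4 : ℝ) ^ n)⁻¹ * (2 ^ n * (2 ^ n + 1))) := by ring
      _ ≤ 2 * d ^ 2 * 2 := by gcongr
      _ = _ := by ring
  have e8 : ((8 ^ n : ℕ) : ℝ) = ((2 ^ n : ℕ) : ℝ) ^ 3 := by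
    push_cast
    rw [← pow_mul, mul_comm, pow_mul]; norm_num
  rw [e8]
  calc ((2 ^ n : ℕ) : ℝ) ^ 3 * (K * ((1 + ε) ^ (2 ^ n : ℕ))⁻¹ * _)
      ≤ ((2 ^ n : ℕ) : ℝ) ^ 3 * (K * ((1 + ε) ^ (2 ^ n : ℕ))⁻¹ * Real.exp (4 * d ^ 2)) := by
        gcongr
    _ = _ := by rw [div_eq_mul_inv]; ring

lemma measure_noHitAll [IsProbabilityMeasure μ] (hB : IsPreBrownianReal B μ)
    (hm : ∀ t, Measurable (B t)) (hB0 : ∀ ω, B 0 ω = 0) (hc : 0 < c) (hd : 0 < d) :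
    μ.real (noHitAll B c d) = 1 - Real.exp (-(2 * d * c)) := by
  have hlim : Tendsto (fun n : ℕ => μ.real (noHit B c d ((4 : ℝ≥0) ^ n)⁻¹ (8 ^ n))) atTop
      (𝓝 (μ.real (noHitAll B c d))) := by
    have := tendsto_measure_iInter_atTop (μ := μ)
      (fun n => (measurableSet_noHit hm _).nullMeasurableSet)
      (noHit_antitone (B := B) (c := c) (d := d)) ⟨0, measure_ne_top _ _⟩
    exact (ENNReal.tendsto_toReal (measure_ne_top _ _)).comp this
  set q := μ.real (noHitAll B c d)
  have hKpos := Real.exp_pos (2 * d * c)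
  set K := Real.exp (2 * d * c) with hK
  have htail : Tendsto (fun n : ℕ => ∫ ω in noHit B c d ((4 : ℝ≥0) ^ n)⁻¹ (8 ^ n),
      mart B d ((8 ^ n : ℕ) * ((4 : ℝ≥0) ^ n)⁻¹) ω ∂μ) atTop (𝓝 0) := by
    have h2 : Tendsto (fun n : ℕ => (2 : ℝ) ^ n) atTop atTop :=
      tendsto_pow_atTop_atTop_of_one_lt (by norm_num)
    have h3 : Tendsto (fun n : ℕ => Real.exp (d * c) * Real.exp (-(d ^ 2 / 2 * (2 : ℝ) ^ n)))
        atTop (𝓝 0) := by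
      have := (Real.tendsto_exp_neg_atTop_nhds_zero.comp
        (h2.const_mul_atTop (r := d ^ 2 / 2) (by positivity))).const_mul (Real.exp (d * c))
      rw [mul_zero] at this
      exact this
    refine squeeze_zero (fun n => (tail_bound hB hm hd _).1) (fun n => ?_) h3
    refine (tail_bound hB hm hd _).2.trans (le_of_eq ?_)
    congr 3
    have : (8 : ℝ) ^ n = 2 ^ n * 4 ^ n := by rw [← mul_pow]; norm_num
    push_cast
    rw [this]
    field_simp
  have hup : K * (1 - q) ≤ 1 := by
    refine le_of_tendsto ((hlim.const_sub 1).const_mul K) (Eventually.of_forall fun n => ?_)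
    have h1 := (main_ineq (δ := ((4 : ℝ≥0) ^ n)⁻¹) hB hm hB0 hc hd one_pos 0 (8 ^ n)).1
    have h2 := (tail_bound (c := c) (δ := ((4 : ℝ≥0) ^ n)⁻¹) hB hm hd (8 ^ n)).1
    linarith
  have hlow : ∀ ε : ℝ, 0 < ε → 1 ≤ (1 + ε) * K * (1 - q) := by
    intro ε hε
    have l1 := htail.const_sub 1
    have l2 := ((hlim.const_sub 1).const_mul ((1 + ε) * K)).add
      (err_tendsto (d := d) ε K hε hKpos)
    have := le_of_tendsto_of_tendsto l1 l2 (Eventually.of_forall fun n =>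
      (main_ineq (δ := ((4 : ℝ≥0) ^ n)⁻¹) hB hm hB0 hc hd hε (2 ^ n) (8 ^ n)).2)
    simpa using this
  have hlow' : 1 ≤ K * (1 - q) := by
    refine le_of_forall_pos_le_add fun ε hε => ?_
    have := hlow ε hε
    nlinarith
  have h1 : K * (1 - q) = 1 := le_antisymm hup hlow'
  rw [Real.exp_neg, ← hK]
  field_simp
  linarith

end LimitPart

section FinalPart

open Filter Topology

variable {Ω : Type*} {G₁ G₂ : ℝ → Ω → ℝ}

lemma noHit_iff {a b h σ η : ℝ} {ω : Ω} (t : ℝ≥0) :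
    bm G₁ G₂ σ t ω < ((h - a) / √2 - η) + ((h - b) / √2 - η) * t ↔
      σ * G₁ (t / (1 + t)) ω + G₂ (t / (1 + t)) ω + a * (1 - t / (1 + t)) + b * (t / (1 + t)) <
        h - √2 * η := by
  have ht : (0 : ℝ) ≤ t := t.2
  have hs : 0 < √(2 : ℝ) := by positivity
  have hs2 : √(2 : ℝ) * √2 = 2 := by norm_num
  have key : ((1 + t) / √2) * (h - √2 * η - (σ * G₁ (t / (1 + t)) ω + G₂ (t / (1 + t)) ω
      + a * (1 - t / (1 + t)) + b * (t / (1 + t)))) =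
      ((h - a) / √2 - η) + ((h - b) / √2 - η) * t - bm G₁ G₂ σ t ω := by
    unfold bm
    field_simp
    ring
  rw [← sub_pos, ← key, mul_pos_iff_of_pos_left (by positivity), sub_pos]

lemma noHitAll_of {a b h σ : ℝ} {ω : Ω}
    (H : ∀ w ∈ Icc (0 : ℝ) 1, σ * G₁ w ω + G₂ w ω + a * (1 - w) + b * w < h) :
    ω ∈ noHitAll (bm G₁ G₂ σ) ((h - a) / √2) ((h - b) / √2) := by
  refine mem_iInter.2 fun n j hj => ?_
  have := (noHit_iff (G₁ := G₁) (G₂ := G₂) (a := a) (b := b) (h := h) (σ := σ) (η := 0) (ω := ω)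
    (j * ((4 : ℝ≥0) ^ n)⁻¹)).2 (by simpa using H _ (w_mem (j * ((4 : ℝ≥0) ^ n)⁻¹)))
  simpa using this

lemma of_noHitAll {a b h σ η : ℝ} (hη : 0 < η) {ω : Ω}
    (hc₁ : Continuous fun w => G₁ w ω) (hc₂ : Continuous fun w => G₂ w ω)
    (h11 : G₁ 1 ω = 0) (h21 : G₂ 1 ω = 0) (hb : b < h)
    (H : ω ∈ noHitAll (bm G₁ G₂ σ) ((h - a) / √2 - η) ((h - b) / √2 - η)) :
    ∀ w ∈ Icc (0 : ℝ) 1, σ * G₁ w ω + G₂ w ω + a * (1 - w) + b * w < h := by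
  intro w hw
  have hs : 0 < √(2 : ℝ) := by positivity
  rcases eq_or_lt_of_le hw.2 with rfl | hw1
  · simp [h11, h21, hb]
  have hw0 := hw.1
  set t : ℝ := w / (1 - w) with ht
  have ht0 : 0 ≤ t := div_nonneg hw0 (by linarith)
  have hwt : w = t / (1 + t) := by
    have : 1 - w ≠ 0 := by linarith
    rw [ht]; field_simp; ring
  let f : ℝ → ℝ := fun w => σ * G₁ w ω + G₂ w ω + a * (1 - w) + b * w
  have hf : Continuous f := by fun_prop
  let u : ℕ → ℝ := fun n => (⌊t * (4 : ℝ) ^ n⌋₊ : ℝ) / (4 : ℝ) ^ n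
  have hu : Tendsto u atTop (𝓝 t) := by
    have h4 : Tendsto (fun n : ℕ => (4 : ℝ) ^ n) atTop atTop :=
      tendsto_pow_atTop_atTop_of_one_lt (by norm_num)
    exact (tendsto_nat_floor_mul_div_atTop ht0).comp h4
  have hlim : Tendsto (fun n => f (u n / (1 + u n))) atTop (𝓝 (f w)) := by
    refine (hf.tendsto w).comp ?_
    rw [hwt]
    exact hu.div (hu.const_add 1) (by positivity)
  have h2 : Tendsto (fun n : ℕ => (2 : ℝ) ^ n) atTop atTop :=
    tendsto_pow_atTop_atTop_of_one_lt (by norm_num)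
  have hle : f w ≤ h - √2 * η := by
    refine le_of_tendsto hlim ?_
    filter_upwards [h2.eventually_ge_atTop t] with n hn
    have hN : ⌊t * (4 : ℝ) ^ n⌋₊ ≤ 8 ^ n := by
      have h8 : (8 : ℝ) ^ n = 2 ^ n * 4 ^ n := by rw [← mul_pow]; norm_num
      have : (⌊t * (4 : ℝ) ^ n⌋₊ : ℝ) ≤ 8 ^ n := by
        refine (Nat.floor_le (by positivity)).trans ?_
        rw [h8]; gcongr
      exact_mod_cast this
    have h3 := mem_iInter.1 H n _ hN
    have h4 := (noHit_iff (G₁ := G₁) (G₂ := G₂) (a := a) (b := b) (h := h) (σ := σ) (η := η)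
      (ω := ω) ((⌊t * (4 : ℝ) ^ n⌋₊ : ℝ≥0) * ((4 : ℝ≥0) ^ n)⁻¹)).1 (by push_cast at h3 ⊢; exact h3)
    have e : (((⌊t * (4 : ℝ) ^ n⌋₊ : ℝ≥0) * ((4 : ℝ≥0) ^ n)⁻¹ : ℝ≥0) : ℝ) = u n := by
      push_cast; rw [← div_eq_mul_inv]
    rw [e] at h4
    exact h4.le
  have : 0 < √2 * η := by positivity
  change f w < h
  linarith

end FinalPart

section ProdPart

variable {Ω : Type*} [MeasurableSpace Ω] {μ : Measure Ω} [IsProbabilityMeasure μ]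
    {G₁ G₂ : ℝ → Ω → ℝ}

lemma noHitAll_prod
    (hmeas₁ : ∀ w : ℝ, Measurable (G₁ w)) (hmeas₂ : ∀ w : ℝ, Measurable (G₂ w))
    (h₁0 : ∀ ω, G₁ 0 ω = 0) (h₂0 : ∀ ω, G₂ 0 ω = 0)
    (hGauss : ∀ (n : ℕ) (ts : Fin n → ℝ) (c d : Fin n → ℝ),
      (∀ i, ts i ∈ Icc (0 : ℝ) 1) →
      Measure.map (fun ω => ∑ i, (c i * G₁ (ts i) ω + d i * G₂ (ts i) ω)) μ =
        gaussianReal 0 (Real.toNNReal (∑ i, ∑ j,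
          (c i * c j + d i * d j) * bridgeCov (ts i) (ts j))))
    {c₁ c₂ d : ℝ} (hc₁ : 0 < c₁) (hc₂ : 0 < c₂) (hd : 0 < d) :
    μ.real (noHitAll (bm G₁ G₂ 1) c₁ d ∩ noHitAll (bm G₁ G₂ (-1)) c₂ d) =
      (1 - Real.exp (-(2 * d * c₁))) * (1 - Real.exp (-(2 * d * c₂))) := by
  have hm : ∀ σ t, Measurable (bm G₁ G₂ σ t) := fun σ t =>
    ((hmeas₁ _).const_mul _).add ((hmeas₂ _).const_mul _)
  have h0 : ∀ σ ω, bm G₁ G₂ σ 0 ω = 0 := fun σ ω => by simp [bm, h₁0, h₂0]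
  have hms : ∀ c, MeasurableSet (noHitAll (fun (t : ℝ≥0) (f : ℝ≥0 → ℝ) => f t) c d) :=
    fun c => measurableSet_noHitAll fun t => measurable_pi_apply t
  have key := (bm_indep hmeas₁ hmeas₂ hGauss).measure_inter_preimage_eq_mul _ _
    (hms c₁) (hms c₂)
  have e : ∀ σ c, (fun ω t => bm G₁ G₂ σ t ω) ⁻¹'
      (noHitAll (fun (t : ℝ≥0) (f : ℝ≥0 → ℝ) => f t) c d) = noHitAll (bm G₁ G₂ σ) c d := by
    intro σ c
    ext ω
    simp [noHitAll, noHit]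
  rw [e, e] at key
  rw [measureReal_def, key, ENNReal.toReal_mul, ← measureReal_def, ← measureReal_def,
    measure_noHitAll (bm_preBrownian hmeas₁ hmeas₂ hGauss (by norm_num)) (hm _) (h0 _) hc₁ hd,
    measure_noHitAll (bm_preBrownian hmeas₁ hmeas₂ hGauss (by norm_num)) (hm _) (h0 _) hc₂ hd]

end ProdPart

/-- Let `G₁, G₂` be two independent standard Brownian bridges on
`[0, 1]` (jointly Gaussian, vanishing at `0` and `1`, continuous paths, covariance
`bridgeCov`, with zero cross-covariance — encoded through the one-dimensional laws of
all finite linear combinations) and `a, b, h ∈ ℝ`.  Then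
`P(max_{w ∈ [0,1]} max{G₁(w)+G₂(w)+a(1−w)+bw, −G₁(w)+G₂(w)−a(1−w)+bw} < h)`
equals `(1 − e^{−(h−a)(h−b)})(1 − e^{−(h+a)(h−b)})` when `h > |a|` and `h > b`,
and equals `0` otherwise. -/
theorem bridge_max_prob
    {Ω : Type*} [MeasurableSpace Ω] (μ : Measure Ω) [IsProbabilityMeasure μ]
    (G₁ G₂ : ℝ → Ω → ℝ)
    (hmeas₁ : ∀ w : ℝ, Measurable (G₁ w)) (hmeas₂ : ∀ w : ℝ, Measurable (G₂ w))
    (hcont₁ : ∀ ω, Continuous fun w => G₁ w ω) (hcont₂ : ∀ ω, Continuous fun w => G₂ w ω)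
    (h₁0 : ∀ ω, G₁ 0 ω = 0) (h₁1 : ∀ ω, G₁ 1 ω = 0)
    (h₂0 : ∀ ω, G₂ 0 ω = 0) (h₂1 : ∀ ω, G₂ 1 ω = 0)
    (hGauss : ∀ (n : ℕ) (ts : Fin n → ℝ) (c d : Fin n → ℝ),
      (∀ i, ts i ∈ Icc (0 : ℝ) 1) →
      Measure.map (fun ω => ∑ i, (c i * G₁ (ts i) ω + d i * G₂ (ts i) ω)) μ =
        gaussianReal 0 (Real.toNNReal (∑ i, ∑ j,
          (c i * c j + d i * d j) * bridgeCov (ts i) (ts j))))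
    (a b h : ℝ) :
    ((|a| < h ∧ b < h) →
      μ {ω | ∀ w ∈ Icc (0 : ℝ) 1,
          max (G₁ w ω + G₂ w ω + a * (1 - w) + b * w)
            (-(G₁ w ω) + G₂ w ω - a * (1 - w) + b * w) < h} =
        ENNReal.ofReal ((1 - Real.exp (-((h - a) * (h - b)))) *
          (1 - Real.exp (-((h + a) * (h - b)))))) ∧
    (¬ (|a| < h ∧ b < h) →
      μ {ω | ∀ w ∈ Icc (0 : ℝ) 1,
          max (G₁ w ω + G₂ w ω + a * (1 - w) + b * w)
            (-(G₁ w ω) + G₂ w ω - a * (1 - w) + b * w) < h} = 0) := by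
  constructor
  · rintro ⟨hah, hbh⟩
    have ha1 : a < h := (le_abs_self a).trans_lt hah
    have ha2 : -a < h := (neg_le_abs a).trans_lt hah
    set E := {ω | ∀ w ∈ Icc (0 : ℝ) 1,
          max (G₁ w ω + G₂ w ω + a * (1 - w) + b * w)
            (-(G₁ w ω) + G₂ w ω - a * (1 - w) + b * w) < h} with hE
    have hs : 0 < √(2 : ℝ) := by positivity
    have hs2 : √(2 : ℝ) ^ 2 = 2 := by norm_num
    let F : ℝ → ℝ := fun η =>
      (1 - Real.exp (-(2 * ((h - b) / √2 - η) * ((h - a) / √2 - η)))) *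
      (1 - Real.exp (-(2 * ((h - b) / √2 - η) * ((h - -a) / √2 - η))))
    have hF : Continuous F := by fun_prop
    have hF0 : F 0 = (1 - Real.exp (-((h - a) * (h - b)))) *
          (1 - Real.exp (-((h + a) * (h - b)))) := by
      simp only [F]
      congr 3
      · congr 1
        field_simp
        rw [hs2]; ring
      · congr 1
        field_simp
        rw [hs2]; ring
    have hup : μ.real E ≤ F 0 := by
      have := noHitAll_prod hmeas₁ hmeas₂ h₁0 h₂0 hGauss (c₁ := (h - a) / √2)
        (c₂ := (h - -a) / √2) (d := (h - b) / √2) (div_pos (by linarith) hs)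
        (div_pos (by linarith) hs) (div_pos (by linarith) hs)
      simp only [F, sub_zero]
      rw [← this]
      refine measureReal_mono fun ω hω => ⟨noHitAll_of fun w hw => ?_, noHitAll_of fun w hw => ?_⟩
      · have := (max_lt_iff.1 (hω w hw)).1
        linarith
      · have := (max_lt_iff.1 (hω w hw)).2
        linarith
    have hlow : ∀ η : ℝ, 0 < η → η < (h - b) / √2 → η < (h - a) / √2 → η < (h - -a) / √2 →
        F η ≤ μ.real E := by
      intro η hη h1 h2 h3
      have := noHitAll_prod hmeas₁ hmeas₂ h₁0 h₂0 hGauss (c₁ := (h - a) / √2 - η)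
        (c₂ := (h - -a) / √2 - η) (d := (h - b) / √2 - η) (by linarith) (by linarith) (by linarith)
      simp only [F]
      rw [← this]
      refine measureReal_mono fun ω hω w hw => max_lt ?_ ?_
      · have := of_noHitAll hη (hcont₁ ω) (hcont₂ ω) (h₁1 ω) (h₂1 ω) hbh hω.1 w hw
        linarith
      · have := of_noHitAll hη (hcont₁ ω) (hcont₂ ω) (h₁1 ω) (h₂1 ω) hbh hω.2 w hw
        linarith
    have hlow0 : F 0 ≤ μ.real E := by
      have hev : ∀ x : ℝ, 0 < x → ∀ᶠ η in nhdsWithin (0 : ℝ) (Ioi 0), η < x := fun x hx =>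
        nhdsWithin_le_nhds (Iio_mem_nhds hx)
      refine le_of_tendsto ((hF.tendsto 0).mono_left (nhdsWithin_le_nhds (s := Ioi 0))) ?_
      filter_upwards [self_mem_nhdsWithin, hev _ (div_pos (by linarith : 0 < h - b) hs),
        hev _ (div_pos (by linarith : 0 < h - a) hs),
        hev _ (div_pos (by linarith : 0 < h - -a) hs)] with η h0 h1 h2 h3
      exact hlow η h0 h1 h2 h3
    rw [← hF0, ← le_antisymm hup hlow0, ofReal_measureReal]
  · intro hn
    have : {ω | ∀ w ∈ Icc (0 : ℝ) 1,
          max (G₁ w ω + G₂ w ω + a * (1 - w) + b * w)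
            (-(G₁ w ω) + G₂ w ω - a * (1 - w) + b * w) < h} = ∅ := by
      refine eq_empty_of_forall_notMem fun ω hω => hn ?_
      have h0 := max_lt_iff.1 (hω 0 (by simp))
      have h1 := max_lt_iff.1 (hω 1 (by simp))
      simp only [h₁0, h₂0, h₁1, h₂1] at h0 h1
      exact ⟨abs_lt.2 ⟨by linarith [h0.2], by linarith [h0.1]⟩, by linarith [h1.1]⟩
    rw [this, measure_empty]


end BrownianBridgeMax
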